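/- arXiv:2601.19007 — 2 statements merged into one kernel-verified Lean document; each statement's English description precedes it below -/
import Mathlib

section
/- Let x_1 < ⋯ < x_n be real points, let σ² > 0, ℓ² > 0, σ_n² > 0, set δ = min_{i≠j} |x_i − x_j| > 0, and let K_θ be the squared-exponential Gram matrix. Define k = ⌈√(3/2 + (2ℓ²/δ²)·log(2σ²ℓ²/(3σ_n²δ²)))⌉ if 2σ²ℓ²/(3σ_n²δ²) > 1, and k = 2 otherwise, and assume n is large enough that k ≤ n. Then L_k(K_θ + σ_n² I) is positive definite. -/
open Matrix BigOperators

/-- The cut-off operator `L_k`: keeps entries within bandwidth `k`, zeroes the rest. -/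
def cutoff {n : ℕ} (k : ℕ) (A : Matrix (Fin n) (Fin n) ℝ) :
    Matrix (Fin n) (Fin n) ℝ :=
  Matrix.of fun i j => if |(i : ℤ) - (j : ℤ)| ≤ (k : ℤ) then A i j else 0

/-- The squared-exponential Gram matrix `(K_θ)_{ij} = σ² exp(−(x_i−x_j)²/(2ℓ²))`. -/
noncomputable def seGram {n : ℕ} (x : Fin n → ℝ) (σ2 l2 : ℝ) :
    Matrix (Fin n) (Fin n) ℝ :=
  Matrix.of fun i j => σ2 * Real.exp (-(x i - x j) ^ 2 / (2 * l2))

/-- The squared-exponential Gram matrix is positive semidefinite (quadratic form version). -/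
theorem seGram_quadForm_nonneg {n : ℕ} (x : Fin n → ℝ) {σ2 l2 : ℝ} (hσ2 : 0 ≤ σ2)
    (hl2 : 0 < l2) (v : Fin n → ℝ) :
    0 ≤ ∑ i, ∑ j, v i * v j * seGram x σ2 l2 i j := by
  set c : Fin n → ℝ := fun i => v i * Real.exp (-(x i) ^ 2 / (2 * l2)) with hc
  have key : ∀ i j, HasSum (fun m : ℕ => σ2 * (c i * c j * ((x i * x j / l2) ^ m / m.factorial)))
      (v i * v j * seGram x σ2 l2 i j) := by
    intro i j
    have h := (NormedSpace.expSeries_div_hasSum_exp (x i * x j / l2)).mul_left (c i * c j)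
    rw [← Real.exp_eq_exp_ℝ] at h
    have h3 : -(x i - x j) ^ 2 / (2 * l2)
        = -(x i) ^ 2 / (2 * l2) + -(x j) ^ 2 / (2 * l2) + x i * x j / l2 := by
      field_simp
      ring
    have h4 : v i * v j * seGram x σ2 l2 i j
        = σ2 * (c i * c j * Real.exp (x i * x j / l2)) := by
      simp only [seGram, Matrix.of_apply, hc, h3, Real.exp_add]
      ring
    rw [h4]
    exact h.mul_left σ2
  refine (hasSum_sum fun i _ => hasSum_sum fun j _ => key i j).nonneg fun m => ?_
  have : ∑ i, ∑ j, σ2 * (c i * c j * ((x i * x j / l2) ^ m / m.factorial))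
      = σ2 / (l2 ^ m * m.factorial) * (∑ i, c i * x i ^ m) ^ 2 := by
    rw [sq, Finset.sum_mul_sum, Finset.mul_sum]
    refine Finset.sum_congr rfl fun i _ => ?_
    rw [Finset.mul_sum]
    refine Finset.sum_congr rfl fun j _ => ?_
    rw [div_pow, mul_pow]
    field_simp
  rw [this]
  positivity

/-- If distinct points are at least `δ` apart, then points with index distance `d` are at least
`d * δ` apart. -/
theorem natAbs_mul_le_abs_sub {n : ℕ} {x : Fin n → ℝ} (hx : StrictMono x) {δ : ℝ}
    (hδ : ∀ i j, i ≠ j → δ ≤ |x i - x j|) (i j : Fin n) :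
    (((i : ℤ) - (j : ℤ)).natAbs : ℝ) * δ ≤ |x i - x j| := by
  have step : ∀ d : ℕ, ∀ i j : Fin n, (j : ℕ) = i + d → d * δ ≤ x j - x i := by
    intro d
    induction d with
    | zero =>
      intro i j h
      have : i = j := Fin.ext (by omega)
      simp [this]
    | succ d ih =>
      intro i j h
      have hj := j.2
      have h1 := ih i ⟨i + d, by omega⟩ rfl
      have hlt : (⟨i + d, by omega⟩ : Fin n) < j := by
        rw [Fin.lt_def]
        simp only
        omega
      have h2 := hδ j ⟨i + d, by omega⟩ hlt.ne'
      rw [abs_of_pos (sub_pos.2 (hx hlt))] at h2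
      push_cast
      linarith
  rcases le_total i j with h | h
  · have := step (j - i) i j (by omega)
    rw [abs_sub_comm, show ((i : ℤ) - (j : ℤ)).natAbs = (j : ℕ) - i by omega]
    exact this.trans (le_abs_self _)
  · have := step (i - j) j i (by omega)
    rw [show ((i : ℤ) - (j : ℤ)).natAbs = (i : ℕ) - j by omega]
    exact this.trans (le_abs_self _)

/-- Summing a nonnegative function of the index distance along a row. -/
theorem sum_natAbs_sub_le {n : ℕ} {f : ℕ → ℝ} (hf : ∀ m, 0 ≤ f m) (i : Fin n) :
    ∑ j : Fin n, f ((i : ℤ) - (j : ℤ)).natAbs ≤ 2 * ∑ m ∈ Finset.range n, f m := by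
  rw [← Finset.sum_filter_add_sum_filter_not Finset.univ (fun j : Fin n => j ≤ i), two_mul]
  refine add_le_add ?_ ?_
  all_goals
    rw [← Finset.sum_image (f := f) (g := fun j : Fin n => ((i : ℤ) - (j : ℤ)).natAbs)]
    · refine Finset.sum_le_sum_of_subset_of_nonneg ?_ fun m _ _ => hf m
      intro m hm
      simp only [Finset.mem_image, Finset.mem_range] at hm ⊢
      obtain ⟨j, -, rfl⟩ := hm
      omega
    · intro a ha b hb hab
      simp only [Finset.coe_filter, Finset.mem_univ, true_and, Set.mem_ofPred_eq] at ha hb hab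
      omega

theorem sum_range_tail_pow_le {r : ℝ} (hr0 : 0 ≤ r) (hr1 : r < 1) (k N : ℕ) :
    ∑ m ∈ Finset.range N, (if k < m then r ^ (m - k) else 0) ≤ r / (1 - r) := by
  calc ∑ m ∈ Finset.range N, (if k < m then r ^ (m - k) else 0)
      ≤ ∑ m ∈ Finset.range (k + 1 + N), (if k < m then r ^ (m - k) else 0) := by
        refine Finset.sum_le_sum_of_subset_of_nonneg ?_ fun m _ _ => ?_
        · exact Finset.range_mono (by omega)
        · split_ifs <;> positivity
    _ = r * ∑ t ∈ Finset.range N, r ^ t := by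
        rw [Finset.sum_range_add, Finset.sum_eq_zero, zero_add, Finset.mul_sum]
        · refine Finset.sum_congr rfl fun t _ => ?_
          rw [if_pos (by omega), show k + 1 + t - k = t + 1 by omega, pow_succ']
        · intro m hm
          rw [Finset.mem_range] at hm
          rw [if_neg (by omega)]
    _ ≤ r / (1 - r) := by
        rw [le_div_iff₀ (by linarith), mul_assoc, geom_sum_mul_neg]
        nlinarith [pow_nonneg hr0 N]

/-- Gaussian tails beyond `k ≥ 2` are dominated by a geometric sequence. -/
theorem exp_neg_sq_le_geometric {a : ℝ} (ha : 0 < a) {k m : ℕ} (hk : 2 ≤ k) (hm : k < m) :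
    Real.exp (-a * (m : ℝ) ^ 2)
      ≤ Real.exp (-a * (k : ℝ) ^ 2) * Real.exp (2 * a) * Real.exp (-7 * a) ^ (m - k) := by
  obtain ⟨t, rfl⟩ : ∃ t, m = k + (t + 1) := ⟨m - k - 1, by omega⟩
  rw [show k + (t + 1) - k = t + 1 by omega, ← Real.exp_nat_mul, ← Real.exp_add, ← Real.exp_add,
    Real.exp_le_exp]
  push_cast
  have hk' : (2 : ℝ) ≤ k := by exact_mod_cast hk
  have ht : (0 : ℝ) ≤ t := t.cast_nonneg
  have ht2 : (t : ℝ) ≤ t ^ 2 := by exact_mod_cast Nat.le_self_pow two_ne_zero t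
  have h : 0 ≤ a * (2 * (k - 2) * (t + 1) + (t ^ 2 - t)) :=
    mul_nonneg ha.le (by nlinarith [mul_nonneg (sub_nonneg.2 hk') ht])
  nlinarith

/-- The numerical inequality behind the choice of bandwidth. -/
theorem six_mul_exp_mul_geometric_lt_one {a : ℝ} (ha : 0 < a) :
    6 * a * Real.exp (-(3 / 2) * a) * Real.exp (2 * a)
      * (Real.exp (-7 * a) / (1 - Real.exp (-7 * a))) < 1 := by
  have h1 : Real.exp (-7 * a) < 1 := Real.exp_lt_one_iff.2 (by linarith)
  rw [mul_div_assoc', div_lt_one (by linarith)]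
  have h2 : Real.exp (-(3 / 2) * a) * Real.exp (2 * a) * Real.exp (-7 * a)
      = Real.exp (-(13 / 2) * a) := by
    rw [← Real.exp_add, ← Real.exp_add]
    ring_nf
  have h3 : Real.exp (-7 * a) ≤ Real.exp (-(13 / 2) * a) := Real.exp_le_exp.2 (by linarith)
  have h4 : Real.exp (-(13 / 2) * a) * Real.exp (13 / 2 * a) = 1 := by
    rw [← Real.exp_add]
    simp
  have h5 := Real.add_one_le_exp (13 / 2 * a)
  have h6 := Real.exp_pos (-(13 / 2) * a)
  calc _ = 6 * a * Real.exp (-(13 / 2) * a) := by rw [← h2]; ring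
    _ < 1 - Real.exp (-(13 / 2) * a) := by nlinarith [mul_pos ha h6]
    _ ≤ _ := by linarith

/-- The chosen bandwidth is at least two and makes the Gaussian factor small enough. -/
theorem bandwidth_spec {σ2 σn2 a : ℝ} (hσ2 : 0 < σ2) (hσn2 : 0 < σn2) (ha : 0 < a) {k : ℕ}
    (hk : k = if 1 < σ2 / (3 * σn2 * a) then
      ⌈Real.sqrt (3 / 2 + 1 / a * Real.log (σ2 / (3 * σn2 * a)))⌉₊ else 2) :
    2 ≤ k ∧ σ2 * Real.exp (-a * (k : ℝ) ^ 2) ≤ 3 * σn2 * a * Real.exp (-(3 / 2) * a) := by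
  split_ifs at hk with hR
  · have hlog := Real.log_pos hR
    set L := Real.log (σ2 / (3 * σn2 * a)) with hL
    have hL0 : 0 < 1 / a * L := by positivity
    have hle : Real.sqrt (3 / 2 + 1 / a * L) ≤ k := hk ▸ Nat.le_ceil _
    have hsq : 3 / 2 + 1 / a * L ≤ (k : ℝ) ^ 2 := (Real.sqrt_le_left (by positivity)).1 hle
    refine ⟨?_, ?_⟩
    · by_contra! h
      have : (k : ℝ) ≤ 1 := by exact_mod_cast Nat.le_of_lt_succ h
      nlinarith [(k.cast_nonneg : (0 : ℝ) ≤ k)]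
    · have h1 : -a * (k : ℝ) ^ 2 ≤ -(3 / 2) * a + -L := by
        have h := mul_le_mul_of_nonneg_left hsq ha.le
        rw [mul_add, ← mul_assoc, mul_one_div_cancel ha.ne'] at h
        linarith
      calc _ ≤ σ2 * Real.exp (-(3 / 2) * a + -L) := by gcongr
        _ = _ := by
          rw [Real.exp_add, Real.exp_neg L, hL, Real.exp_log (by positivity)]
          field_simp
  · subst hk
    refine ⟨le_rfl, ?_⟩
    rw [not_lt, div_le_one (by positivity)] at hR
    refine mul_le_mul hR (Real.exp_le_exp.2 ?_) (Real.exp_pos _).le (by positivity)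
    push_cast
    linarith

/-- Schur test: the quadratic form of a symmetric nonnegative matrix is bounded through its row
sums. -/
theorem quadForm_le_of_row_sum_le {n : ℕ} {E : Fin n → Fin n → ℝ} (hE : ∀ i j, 0 ≤ E i j)
    (hsymm : ∀ i j, E i j = E j i) {B : ℝ} (hB : ∀ i, ∑ j, E i j ≤ B) (v : Fin n → ℝ) :
    ∑ i, ∑ j, v i * v j * E i j ≤ B * ∑ i, v i ^ 2 := by
  have hswap : ∑ i, ∑ j, v j ^ 2 * E i j = ∑ i, ∑ j, v i ^ 2 * E i j := by
    rw [Finset.sum_comm]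
    simp_rw [hsymm]
  calc ∑ i, ∑ j, v i * v j * E i j
      ≤ ∑ i, ∑ j, (v i ^ 2 * E i j / 2 + v j ^ 2 * E i j / 2) := by
        gcongr with i _ j _
        nlinarith [mul_nonneg (hE i j) (sq_nonneg (v i - v j))]
    _ = ∑ i, v i ^ 2 * ∑ j, E i j := by
        simp_rw [Finset.sum_add_distrib, ← Finset.sum_div, hswap, add_halves, Finset.mul_sum]
    _ ≤ B * ∑ i, v i ^ 2 := by
        rw [Finset.mul_sum]
        refine Finset.sum_le_sum fun i _ => ?_
        rw [mul_comm B]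
        exact mul_le_mul_of_nonneg_left (hB i) (sq_nonneg _)

theorem seGram_comm {n : ℕ} (x : Fin n → ℝ) (σ2 l2 : ℝ) (i j : Fin n) :
    seGram x σ2 l2 i j = seGram x σ2 l2 j i := by
  simp only [seGram, Matrix.of_apply]
  rw [show (x i - x j) ^ 2 = (x j - x i) ^ 2 by ring]

/-- The part of the squared-exponential Gram matrix outside the band has row sums bounded by a
geometric tail. -/
theorem seGram_offBand_row_sum_le {n : ℕ} {x : Fin n → ℝ} (hx : StrictMono x)
    {σ2 l2 δ : ℝ} (hσ2 : 0 < σ2) (hl2 : 0 < l2) (hδ0 : 0 < δ)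
    (hδ : ∀ i j, i ≠ j → δ ≤ |x i - x j|) {k : ℕ} (hk : 2 ≤ k) (i : Fin n) :
    ∑ j : Fin n, (if k < ((i : ℤ) - (j : ℤ)).natAbs then seGram x σ2 l2 i j else 0)
      ≤ 2 * (σ2 * Real.exp (-(δ ^ 2 / (2 * l2)) * (k : ℝ) ^ 2))
        * Real.exp (2 * (δ ^ 2 / (2 * l2)))
        * (Real.exp (-7 * (δ ^ 2 / (2 * l2))) / (1 - Real.exp (-7 * (δ ^ 2 / (2 * l2))))) := by
  set a := δ ^ 2 / (2 * l2) with ha_def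
  have ha : 0 < a := by positivity
  set r := Real.exp (-7 * a) with hr
  have hr1 : r < 1 := Real.exp_lt_one_iff.2 (by linarith)
  have hr0 : 0 < r := Real.exp_pos _
  set C := σ2 * Real.exp (-a * (k : ℝ) ^ 2) * Real.exp (2 * a) with hC
  have hC0 : 0 < C := by positivity
  have hterm : ∀ j : Fin n, (if k < ((i : ℤ) - (j : ℤ)).natAbs then seGram x σ2 l2 i j else 0)
      ≤ C * (fun m => if k < m then r ^ (m - k) else 0) ((i : ℤ) - (j : ℤ)).natAbs := by
    intro j
    have hd := natAbs_mul_le_abs_sub hx hδ i j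
    generalize ((i : ℤ) - (j : ℤ)).natAbs = m at hd ⊢
    by_cases hm : k < m
    · simp only [if_pos hm]
      have hsq : ((m : ℝ) * δ) ^ 2 ≤ (x i - x j) ^ 2 := by
        rw [← sq_abs (x i - x j)]
        gcongr
      calc seGram x σ2 l2 i j ≤ σ2 * Real.exp (-a * (m : ℝ) ^ 2) := by
            simp only [seGram, Matrix.of_apply]
            gcongr
            rw [ha_def, show -(δ ^ 2 / (2 * l2)) * (m : ℝ) ^ 2 = -((m : ℝ) * δ) ^ 2 / (2 * l2) by
              ring]
            gcongr
        _ ≤ σ2 * (Real.exp (-a * (k : ℝ) ^ 2) * Real.exp (2 * a) * r ^ (m - k)) := by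
            gcongr
            exact exp_neg_sq_le_geometric ha hk hm
        _ = C * r ^ (m - k) := by rw [hC]; ring
    · simp [if_neg hm]
  calc _ ≤ ∑ j : Fin n, C * (fun m => if k < m then r ^ (m - k) else 0)
        ((i : ℤ) - (j : ℤ)).natAbs := Finset.sum_le_sum fun j _ => hterm j
    _ ≤ C * (2 * (r / (1 - r))) := by
        rw [← Finset.mul_sum]
        gcongr
        refine (sum_natAbs_sub_le (f := fun m => if k < m then r ^ (m - k) else 0)
          (fun m => ?_) i).trans ?_
        · split_ifs <;> positivity
        · gcongr
          exact sum_range_tail_pow_le hr0.le hr1 k n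
    _ = _ := by rw [hC]; ring

/-- **Corollary (Choice of k for a cut-off SE-kernel with noise).**
With `k = ⌈√(3/2 + (2ℓ²/δ²) log(2σ²ℓ²/(3σ_n²δ²)))⌉` when `2σ²ℓ²/(3σ_n²δ²) > 1`
and `k = 2` otherwise, `L_k(K_θ + σ_n² I)` is positive definite. -/
theorem cutoff_seGram_explicit_k_posDef {n : ℕ}
    (x : Fin n → ℝ) (hx : StrictMono x)
    (σ2 l2 σn2 δ : ℝ) (hσ2 : 0 < σ2) (hl2 : 0 < l2) (hσn2 : 0 < σn2)
    (hδ : IsLeast {d : ℝ | ∃ i j : Fin n, i ≠ j ∧ d = |x i - x j|} δ) (hδ0 : 0 < δ)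
    (k : ℕ)
    (hkdef : k =
      if 1 < 2 * σ2 * l2 / (3 * σn2 * δ ^ 2) then
        ⌈Real.sqrt (3 / 2 + 2 * l2 / δ ^ 2 * Real.log (2 * σ2 * l2 / (3 * σn2 * δ ^ 2)))⌉₊
      else 2)
    (hk : k ≤ n) :
    (cutoff k (seGram x σ2 l2 + σn2 • (1 : Matrix (Fin n) (Fin n) ℝ))).PosDef := by
  set a := δ ^ 2 / (2 * l2) with ha_def
  have ha : 0 < a := by positivity
  have hδ' : ∀ i j, i ≠ j → δ ≤ |x i - x j| := fun i j hij => hδ.2 ⟨i, j, hij, rfl⟩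
  have hR : 2 * σ2 * l2 / (3 * σn2 * δ ^ 2) = σ2 / (3 * σn2 * a) := by
    rw [ha_def]
    field_simp
  have hinv : 2 * l2 / δ ^ 2 = 1 / a := by
    rw [ha_def, one_div_div]
  rw [hR, hinv] at hkdef
  obtain ⟨hk2, hkexp⟩ := bandwidth_spec hσ2 hσn2 ha hkdef
  have hr1 : Real.exp (-7 * a) < 1 := Real.exp_lt_one_iff.2 (by linarith)
  set G := Real.exp (-7 * a) / (1 - Real.exp (-7 * a)) with hG
  have hG0 : 0 < G := div_pos (Real.exp_pos _) (by linarith)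
  set B := 2 * (σ2 * Real.exp (-a * (k : ℝ) ^ 2)) * Real.exp (2 * a) * G with hB
  have hBlt : B < σn2 := by
    calc B ≤ 2 * (3 * σn2 * a * Real.exp (-(3 / 2) * a)) * Real.exp (2 * a) * G := by
          rw [hB]
          gcongr
      _ = σn2 * (6 * a * Real.exp (-(3 / 2) * a) * Real.exp (2 * a) * G) := by ring
      _ < σn2 := mul_lt_of_lt_one_right hσn2 (six_mul_exp_mul_geometric_lt_one ha)
  set E : Fin n → Fin n → ℝ := fun i j =>
    if k < ((i : ℤ) - (j : ℤ)).natAbs then seGram x σ2 l2 i j else 0 with hE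
  have hE0 : ∀ i j, 0 ≤ E i j := by
    intro i j
    simp only [hE, seGram, Matrix.of_apply]
    split_ifs <;> positivity
  have hnatAbs : ∀ i j : Fin n, ((i : ℤ) - (j : ℤ)).natAbs = ((j : ℤ) - (i : ℤ)).natAbs :=
    fun i j => by omega
  have hEsymm : ∀ i j, E i j = E j i := by
    intro i j
    simp only [hE]
    rw [hnatAbs, seGram_comm]
  have hentry : ∀ i j, cutoff k (seGram x σ2 l2 + σn2 • (1 : Matrix (Fin n) (Fin n) ℝ)) i j
      = seGram x σ2 l2 i j - E i j + σn2 * (if i = j then 1 else 0) := by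
    intro i j
    simp only [cutoff, Matrix.of_apply, Matrix.add_apply, Matrix.smul_apply, Matrix.one_apply,
      smul_eq_mul, hE, Int.abs_eq_natAbs, Nat.cast_le]
    by_cases h : k < ((i : ℤ) - (j : ℤ)).natAbs
    · have hij : i ≠ j := by
        rintro rfl
        simp at h
      rw [if_neg (by omega), if_pos h, if_neg hij]
      ring
    · rw [if_pos (by omega), if_neg h]
      ring
  refine Matrix.PosDef.of_dotProduct_mulVec_pos ?_ fun v hv => ?_
  · ext i j
    rw [Matrix.conjTranspose_apply, star_trivial, hentry, hentry, seGram_comm, hEsymm]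
    simp only [eq_comm]
  · have hform : star v ⬝ᵥ (cutoff k (seGram x σ2 l2 + σn2 • (1 : Matrix (Fin n) (Fin n) ℝ)) *ᵥ v)
        = ∑ i, ∑ j, v i * v j * seGram x σ2 l2 i j - ∑ i, ∑ j, v i * v j * E i j
          + σn2 * ∑ i, v i ^ 2 := by
      rw [Finset.mul_sum, ← Finset.sum_sub_distrib, ← Finset.sum_add_distrib]
      simp only [dotProduct, Matrix.mulVec, star_trivial]
      refine Finset.sum_congr rfl fun i _ => ?_
      have hdiag : σn2 * v i ^ 2 = ∑ j, v i * v j * (σn2 * (if i = j then 1 else 0)) := by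
        simp
        ring
      rw [hdiag, ← Finset.sum_sub_distrib, ← Finset.sum_add_distrib, Finset.mul_sum]
      refine Finset.sum_congr rfl fun j _ => ?_
      rw [hentry]
      ring
    have hpos : 0 < ∑ i, v i ^ 2 := by
      obtain ⟨i, hi⟩ := Function.ne_iff.1 hv
      exact Finset.sum_pos' (fun j _ => sq_nonneg _) ⟨i, Finset.mem_univ i, sq_pos_of_ne_zero hi⟩
    have hK := seGram_quadForm_nonneg x hσ2.le hl2 v
    have hEB := quadForm_le_of_row_sum_le hE0 hEsymm
      (fun i => seGram_offBand_row_sum_le hx hσ2 hl2 hδ0 hδ' hk2 i) v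
    have hlt := mul_lt_mul_of_pos_right hBlt hpos
    rw [hform]
    linarith
end

section
/- Let x_1 < ⋯ < x_n be real training points with δ = min_{i≠j} |x_i − x_j| > 0, let σ² > 0, ℓ² > 0, σ_n² > 0, and let K_{f,f} ∈ ℝ^{n×n} be the squared-exponential Gram matrix of the training points. Suppose k ≤ n is chosen such that there exists ε with (K_{f,f})_{ij} ≤ ε for all |i−j| > k and ε ≤ (3σ_n²δ²)/(4ℓ²)·exp(−3δ²/(2ℓ²)). Let x*_1, …, x*_p be test points that are pairwise distinct and distinct from all training points, and let K_{∗,∗} ∈ ℝ^{p×p}, K_{f,∗} ∈ ℝ^{n×p}, K_{∗,f} = K_{f,∗}^⊤ be the squared-exponential cross-Gram matrices with the same parameters σ², ℓ². Then the predictive covariance matrix Σ̃ = K_{∗,∗} − K_{∗,f} (L_k(K_{f,f}) + σ_n² I)^{−1} K_{f,∗} is positive definite. -/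
open Matrix BigOperators

/-- Matrix of pairwise squared-exponential kernel evaluations between two point sets. -/
noncomputable def seCross {n p : ℕ} (x : Fin n → ℝ) (y : Fin p → ℝ) (σ2 l2 : ℝ) :
    Matrix (Fin n) (Fin p) ℝ :=
  Matrix.of fun i j => σ2 * Real.exp (-(x i - y j) ^ 2 / (2 * l2))

/-- The matrix `exp (s aᵢ aⱼ)` is positive definite for `s > 0` and distinct nodes `aᵢ`. -/
theorem posDef_exp_mul {ι : Type*} [Fintype ι] {a : ι → ℝ} (ha : Function.Injective a)
    {s : ℝ} (hs : 0 < s) :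
    (Matrix.of fun i j => Real.exp (s * (a i * a j)) : Matrix ι ι ℝ).PosDef := by
  classical
  refine .of_dotProduct_mulVec_pos ?_ fun c hc => ?_
  · ext i j
    simp [mul_comm]
  have hsum : HasSum (fun m : ℕ => s ^ m / (m.factorial : ℝ) * (∑ i, c i * a i ^ m) ^ 2)
      (star c ⬝ᵥ ((Matrix.of fun i j => Real.exp (s * (a i * a j)) : Matrix ι ι ℝ) *ᵥ c)) := by
    have h : HasSum (fun m : ℕ => ∑ i, c i * ∑ j,
          (s * (a i * a j)) ^ m / (m.factorial : ℝ) * c j)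
        (∑ i, c i * ∑ j, Real.exp (s * (a i * a j)) * c j) := by
      refine hasSum_sum fun i _ => HasSum.mul_left _ (hasSum_sum fun j _ => HasSum.mul_right _ ?_)
      rw [Real.exp_eq_exp_ℝ]
      exact NormedSpace.expSeries_div_hasSum_exp _
    simp only [dotProduct, mulVec, star_trivial, Matrix.of_apply]
    convert h using 2 with m
    rw [sq, Finset.sum_mul_sum, Finset.mul_sum]
    refine Finset.sum_congr rfl fun i _ => ?_
    rw [Finset.mul_sum, Finset.mul_sum]
    refine Finset.sum_congr rfl fun j _ => ?_
    ring
  have hnonneg : ∀ m : ℕ, 0 ≤ s ^ m / (m.factorial : ℝ) * (∑ i, c i * a i ^ m) ^ 2 :=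
    fun m => by positivity
  refine lt_of_le_of_ne (hsum.nonneg hnonneg) fun h0 => hc ?_
  rw [← h0] at hsum
  have hmom : ∀ m : ℕ, ∑ i, c i * a i ^ m = 0 := fun m => by
    have h := congrFun ((hasSum_zero_iff_of_nonneg hnonneg).1 hsum) m
    have hpos : 0 < s ^ m / (m.factorial : ℝ) := by positivity
    simpa [hpos.ne'] using h
  have hpoly : ∀ P : Polynomial ℝ, ∑ i, c i * P.eval (a i) = 0 := fun P => by
    simp_rw [Polynomial.eval_eq_sum_range, Finset.mul_sum]
    rw [Finset.sum_comm]
    refine Finset.sum_eq_zero fun m _ => ?_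
    rw [← mul_zero (P.coeff m), ← hmom m, Finset.mul_sum]
    exact Finset.sum_congr rfl fun i _ => by ring
  ext i
  have h := hpoly (Lagrange.basis Finset.univ a i)
  rw [Finset.sum_eq_single i] at h
  · simpa [Lagrange.eval_basis_self ha.injOn (Finset.mem_univ i)] using h
  · intro j _ hj
    rw [Lagrange.eval_basis_of_ne hj.symm (Finset.mem_univ j), mul_zero]
  · simp

/-- The squared-exponential Gram matrix of distinct points is positive definite. -/
theorem posDef_squaredExponential {ι : Type*} [Fintype ι] {v : ι → ℝ}
    (hv : Function.Injective v) {σ2 l2 : ℝ} (hσ2 : 0 < σ2) (hl2 : 0 < l2) :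
    (Matrix.of fun i j => σ2 * Real.exp (-(v i - v j) ^ 2 / (2 * l2)) :
      Matrix ι ι ℝ).PosDef := by
  classical
  have hinj : Function.Injective
      (diagonal fun i => Real.exp (-(v i) ^ 2 / (2 * l2)) : Matrix ι ι ℝ).mulVec := by
    intro y z hyz
    ext i
    have h := congrFun hyz i
    simpa [mulVec_diagonal, (Real.exp_pos _).ne'] using h
  have h := ((posDef_exp_mul hv (inv_pos.2 hl2)).conjTranspose_mul_mul_same hinj).smul hσ2
  convert h using 1
  ext i j
  simp only [diagonal_conjTranspose, Matrix.of_apply, Matrix.smul_apply, mul_diagonal,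
    diagonal_mul, smul_eq_mul, star_trivial, ← Real.exp_add]
  congr 2
  field_simp
  ring

/-- The Schur complement of a positive definite block in a positive definite matrix is
positive definite. -/
theorem Matrix.PosDef.schurComplement {m n : Type*} [Fintype m] [DecidableEq m] [Fintype n]
    {A : Matrix m m ℝ} {B : Matrix m n ℝ} {D : Matrix n n ℝ} (hA : A.PosDef)
    (h : (fromBlocks A B Bᴴ D).PosDef) : (D - Bᴴ * A⁻¹ * B).PosDef := by
  let : Invertible A := hA.isUnit.invertible
  refine .of_dotProduct_mulVec_pos ((IsHermitian.fromBlocks₁₁ B D hA.1).1 h.1) fun y hy => ?_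
  have hne : Sum.elim (-((A⁻¹ * B) *ᵥ y)) y ≠ 0 := fun h0 =>
    hy (funext fun i => congrFun h0 (Sum.inr i))
  have hpos := h.dotProduct_mulVec_pos hne
  rwa [dotProduct_mulVec, schur_complement_eq₁₁ B D _ _ hA.1, neg_add_cancel, dotProduct_zero,
    zero_add, ← dotProduct_mulVec] at hpos

/-- A symmetric matrix with nonnegative entries and row sums at most `c` satisfies `T ≤ c • 1`. -/
theorem posSemidef_smul_one_sub {ι : Type*} [Fintype ι] [DecidableEq ι] {T : Matrix ι ι ℝ}
    (hsymm : T.IsSymm) (hT : ∀ i j, 0 ≤ T i j) {c : ℝ} (hrow : ∀ i, ∑ j, T i j ≤ c) :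
    (c • (1 : Matrix ι ι ℝ) - T).PosSemidef := by
  refine .of_dotProduct_mulVec_nonneg ?_ fun y => ?_
  · rw [IsHermitian, conjTranspose_eq_transpose_of_trivial]
    simp [hsymm.eq]
  have hswap : ∑ i, ∑ j, T i j * y j ^ 2 = ∑ i, ∑ j, T i j * y i ^ 2 := by
    rw [Finset.sum_comm]
    exact Finset.sum_congr rfl fun i _ => Finset.sum_congr rfl fun j _ => by
      rw [hsymm.apply]
  have hquad : ∑ i, ∑ j, y i * (T i j * y j) ≤ ∑ i, ∑ j, T i j * y i ^ 2 := by
    have h : ∑ i, ∑ j, 2 * (y i * (T i j * y j)) ≤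
        ∑ i, ∑ j, (T i j * y i ^ 2 + T i j * y j ^ 2) :=
      Finset.sum_le_sum fun i _ => Finset.sum_le_sum fun j _ => by
        nlinarith [mul_nonneg (hT i j) (sq_nonneg (y i - y j))]
    simp only [Finset.sum_add_distrib, hswap, ← Finset.mul_sum] at h ⊢
    linarith
  have hbound : ∑ i, ∑ j, T i j * y i ^ 2 ≤ ∑ i, c * y i ^ 2 :=
    Finset.sum_le_sum fun i _ => by
      rw [← Finset.sum_mul]
      exact mul_le_mul_of_nonneg_right (hrow i) (sq_nonneg _)
  have hval : star y ⬝ᵥ ((c • (1 : Matrix ι ι ℝ) - T) *ᵥ y) =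
      ∑ i, c * y i ^ 2 - ∑ i, ∑ j, y i * (T i j * y j) := by
    simp only [sub_mulVec, smul_mulVec, one_mulVec, dotProduct_sub, star_trivial]
    simp only [dotProduct, mulVec, Finset.mul_sum, Pi.smul_apply, smul_eq_mul]
    congr 1
    exact Finset.sum_congr rfl fun i _ => by ring
  rw [hval]
  linarith

/-- A geometric sum over distinct exponents is at most the full geometric series. -/
theorem sum_pow_le_inv_one_sub {ι : Type*} {s : Finset ι} {f : ι → ℕ}
    (hf : Set.InjOn f s) {r : ℝ} (hr0 : 0 ≤ r) (hr1 : r < 1) :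
    ∑ i ∈ s, r ^ f i ≤ (1 - r)⁻¹ := by
  classical
  rw [← Finset.sum_image (f := fun m => r ^ m) hf, ← tsum_geometric_of_lt_one hr0 hr1]
  exact (summable_geometric_of_lt_one hr0 hr1).sum_le_tsum _ fun m _ => pow_nonneg hr0 m

/-- Increasing points with gaps at least `δ` satisfy `xⱼ - xᵢ ≥ (j - i) δ`. -/
theorem mul_le_sub_of_separated {n : ℕ} {x : Fin n → ℝ} (hx : StrictMono x) {δ : ℝ}
    (hsep : ∀ i j : Fin n, i ≠ j → δ ≤ |x i - x j|) (m : ℕ) :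
    ∀ i j : Fin n, (j : ℕ) = i + m → m * δ ≤ x j - x i := by
  induction m with
  | zero =>
    intro i j hij
    obtain rfl : j = i := Fin.ext hij
    simp
  | succ m ih =>
    intro i j hij
    let l : Fin n := ⟨i + m, by omega⟩
    have hlj : l < j := Fin.lt_def.2 (by simp only [l]; omega)
    have h₁ := ih i l rfl
    have h₂ := hsep j l hlj.ne'
    rw [abs_of_pos (sub_pos.2 (hx hlj))] at h₂
    push_cast
    linarith

/-- Beyond the bandwidth `k`, the squared-exponential kernel decays geometrically. -/
theorem seCross_le_mul_pow {n k : ℕ} {x : Fin n → ℝ} (hx : StrictMono x)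
    {σ2 l2 δ ε : ℝ} (hσ2 : 0 < σ2) (hl2 : 0 < l2) (hδ0 : 0 < δ)
    (hsep : ∀ i j : Fin n, i ≠ j → δ ≤ |x i - x j|)
    (hε : ∀ i j : Fin n, (k : ℤ) < |(i : ℤ) - (j : ℤ)| → seCross x x σ2 l2 i j ≤ ε)
    {i j : Fin n} (hij : (i : ℕ) + k < j) :
    seCross x x σ2 l2 i j ≤
      ε * Real.exp (-(3 * δ ^ 2) / (2 * l2)) ^ ((j : ℕ) - (i + k + 1)) := by
  let l : Fin n := ⟨i + k + 1, by omega⟩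
  set m : ℕ := (j : ℕ) - (i + k + 1) with hm
  have hil : i < l := Fin.lt_def.2 (by simp only [l]; omega)
  have hgap : m * δ ≤ x j - x l :=
    mul_le_sub_of_separated hx hsep m l j (by simp only [l]; omega)
  have hδl : δ ≤ x l - x i := by
    have h := hsep l i hil.ne'
    rwa [abs_of_pos (sub_pos.2 (hx hil))] at h
  have hl : seCross x x σ2 l2 i l ≤ ε := hε i l (by
    rw [abs_sub_comm]
    refine lt_of_lt_of_le ?_ (le_abs_self _)
    simp only [l]
    push_cast
    omega)
  have hm2 : (m : ℝ) ≤ (m : ℝ) ^ 2 := by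
    exact_mod_cast Nat.le_self_pow two_ne_zero m
  have hm0 : (0 : ℝ) ≤ m * δ := by positivity
  have hsq : (x i - x l) ^ 2 + m * (3 * δ ^ 2) ≤ (x i - x j) ^ 2 := by
    have h₁ : (m * δ) * δ ≤ (x j - x l) * (x l - x i) :=
      mul_le_mul hgap hδl hδ0.le (hm0.trans hgap)
    have h₂ : (m * δ) ^ 2 ≤ (x j - x l) ^ 2 := pow_le_pow_left₀ hm0 hgap 2
    nlinarith [mul_le_mul_of_nonneg_right hm2 (sq_nonneg δ)]
  refine le_trans ?_ (mul_le_mul_of_nonneg_right hl (by positivity))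
  simp only [seCross, Matrix.of_apply]
  rw [mul_assoc, ← Real.exp_nat_mul, ← Real.exp_add]
  gcongr
  rw [← mul_div_assoc, ← add_div]
  gcongr
  linarith

/-- The part of the squared-exponential Gram matrix discarded by the cut-off has row sums at most
the noise variance. -/
theorem sum_sub_cutoff_le {n k : ℕ} {x : Fin n → ℝ} (hx : StrictMono x)
    {σ2 l2 σn2 δ ε : ℝ} (hσ2 : 0 < σ2) (hl2 : 0 < l2) (hσn2 : 0 < σn2) (hδ0 : 0 < δ)
    (hsep : ∀ i j : Fin n, i ≠ j → δ ≤ |x i - x j|)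
    (hε : ∀ i j : Fin n, (k : ℤ) < |(i : ℤ) - (j : ℤ)| → seCross x x σ2 l2 i j ≤ ε)
    (hεbound : ε ≤ 3 * σn2 * δ ^ 2 / (4 * l2) * Real.exp (-(3 * δ ^ 2) / (2 * l2)))
    (i : Fin n) :
    ∑ j, (seCross x x σ2 l2 - cutoff k (seCross x x σ2 l2)) i j ≤ σn2 := by
  have hsymm : ∀ i j : Fin n, seCross x x σ2 l2 i j = seCross x x σ2 l2 j i := fun i j => by
    simp only [seCross, Matrix.of_apply]
    rw [← neg_sub (x j) (x i), neg_sq]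
  set t : ℝ := 3 * δ ^ 2 / (2 * l2) with ht
  have ht0 : 0 < t := by positivity
  set r : ℝ := Real.exp (-(3 * δ ^ 2) / (2 * l2)) with hr
  have hr0 : 0 < r := Real.exp_pos _
  have hrt : r = Real.exp (-t) := by rw [hr, ht, neg_div]
  have hr1 : r < 1 := by rw [hrt]; exact Real.exp_lt_one_iff.2 (by linarith)
  set ε' : ℝ := σn2 / 2 * (t * r) with hε'
  have hle : ε ≤ ε' := hεbound.trans_eq (by rw [hε', ht]; field_simp; ring)
  have hε'0 : 0 ≤ ε' := by positivity
  have htr : t * r ≤ 1 - r := by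
    have h := Real.add_one_le_exp t
    have h₁ : Real.exp t * r = 1 := by rw [hrt, ← Real.exp_add]; simp
    nlinarith [mul_le_mul_of_nonneg_right h hr0.le]
  have hentry : ∀ j, (seCross x x σ2 l2 - cutoff k (seCross x x σ2 l2)) i j ≤
      (if (i : ℕ) + k < j then ε' * r ^ ((j : ℕ) - (i + k + 1)) else 0) +
        (if (j : ℕ) + k < i then ε' * r ^ ((i : ℕ) - (j + k + 1)) else 0) := by
    intro j
    simp only [Matrix.sub_apply, cutoff, Matrix.of_apply]
    by_cases h₁ : (i : ℕ) + k < j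
    · have h := (seCross_le_mul_pow hx hσ2 hl2 hδ0 hsep hε h₁).trans
        (mul_le_mul_of_nonneg_right hle (by positivity))
      have h₂ : ¬ |(i : ℤ) - (j : ℤ)| ≤ (k : ℤ) := by rw [abs_le]; omega
      have h₃ : ¬ (j : ℕ) + k < i := by omega
      simpa [h₁, h₂, h₃] using h
    by_cases h₂ : (j : ℕ) + k < i
    · have h := (seCross_le_mul_pow hx hσ2 hl2 hδ0 hsep hε h₂).trans
        (mul_le_mul_of_nonneg_right hle (by positivity))
      rw [hsymm] at h
      have h₃ : ¬ |(i : ℤ) - (j : ℤ)| ≤ (k : ℤ) := by rw [abs_le]; omega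
      simpa [h₁, h₂, h₃] using h
    · have h₃ : |(i : ℤ) - (j : ℤ)| ≤ (k : ℤ) := by rw [abs_le]; omega
      simp [h₁, h₂, h₃]
  have hgeom : ε' * (1 - r)⁻¹ ≤ σn2 / 2 := by
    rw [← div_eq_mul_inv, div_le_iff₀ (by linarith), hε']
    gcongr
  refine (Finset.sum_le_sum fun j _ => hentry j).trans ?_
  rw [Finset.sum_add_distrib, ← Finset.sum_filter, ← Finset.sum_filter, ← Finset.mul_sum,
    ← Finset.mul_sum]
  have hright : ∑ j ∈ Finset.univ.filter (fun j : Fin n => (i : ℕ) + k < j),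
      r ^ ((j : ℕ) - (i + k + 1)) ≤ (1 - r)⁻¹ := by
    refine sum_pow_le_inv_one_sub (fun a ha b hb hab => Fin.ext ?_) hr0.le hr1
    simp only [Finset.coe_filter, Finset.mem_univ, true_and, Set.mem_ofPred_eq] at ha hb hab
    omega
  have hleft : ∑ j ∈ Finset.univ.filter (fun j : Fin n => (j : ℕ) + k < i),
      r ^ ((i : ℕ) - (j + k + 1)) ≤ (1 - r)⁻¹ := by
    refine sum_pow_le_inv_one_sub (fun a ha b hb hab => Fin.ext ?_) hr0.le hr1
    simp only [Finset.coe_filter, Finset.mem_univ, true_and, Set.mem_ofPred_eq] at ha hb hab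
    omega
  linarith [mul_le_mul_of_nonneg_left hright hε'0, mul_le_mul_of_nonneg_left hleft hε'0]

/-- **Theorem (Positive definiteness of the predictive covariance).**
The BTC predictive covariance
`Σ̃ = K_{∗,∗} − K_{∗,f} (L_k(K_{f,f}) + σ_n² I)⁻¹ K_{f,∗}` is positive definite. -/
theorem predictive_covariance_posDef {n p : ℕ} (k : ℕ) (hk : k ≤ n)
    (x : Fin n → ℝ) (hx : StrictMono x)
    (σ2 l2 σn2 δ : ℝ) (hσ2 : 0 < σ2) (hl2 : 0 < l2) (hσn2 : 0 < σn2)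
    (hδ : IsLeast {d : ℝ | ∃ i j : Fin n, i ≠ j ∧ d = |x i - x j|} δ) (hδ0 : 0 < δ)
    (ε : ℝ)
    (hε : ∀ i j : Fin n, (k : ℤ) < |(i : ℤ) - (j : ℤ)| → seCross x x σ2 l2 i j ≤ ε)
    (hεbound : ε ≤ 3 * σn2 * δ ^ 2 / (4 * l2) * Real.exp (-(3 * δ ^ 2) / (2 * l2)))
    (xs : Fin p → ℝ) (hxs : Function.Injective xs)
    (hdisj : ∀ (i : Fin n) (j : Fin p), xs j ≠ x i) :
    (seCross xs xs σ2 l2 -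
      seCross xs x σ2 l2 *
        (cutoff k (seCross x x σ2 l2) + σn2 • (1 : Matrix (Fin n) (Fin n) ℝ))⁻¹ *
        seCross x xs σ2 l2).PosDef := by
  have hsep : ∀ i j : Fin n, i ≠ j → δ ≤ |x i - x j| := fun i j hij => hδ.2 ⟨i, j, hij, rfl⟩
  set K := seCross x x σ2 l2 with hK
  have hKsymm : ∀ i j, K i j = K j i := fun i j => by
    simp only [hK, seCross, Matrix.of_apply]
    rw [← neg_sub (x j) (x i), neg_sq]
  have hN : (σn2 • (1 : Matrix (Fin n) (Fin n) ℝ) - (K - cutoff k K)).PosSemidef := by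
    refine posSemidef_smul_one_sub (Matrix.IsSymm.ext fun i j => ?_) (fun i j => ?_)
      (sum_sub_cutoff_le hx hσ2 hl2 hσn2 hδ0 hsep hε hεbound)
    · simp only [Matrix.sub_apply, cutoff, Matrix.of_apply, hKsymm j i,
        abs_sub_comm (j : ℤ) (i : ℤ)]
    · have hpos : 0 ≤ K i j := by
        simp only [hK, seCross, Matrix.of_apply]
        positivity
      simp only [Matrix.sub_apply, cutoff, Matrix.of_apply]
      split_ifs <;> simp [hpos]
  have hM : cutoff k K + σn2 • (1 : Matrix (Fin n) (Fin n) ℝ) =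
      K + (σn2 • (1 : Matrix (Fin n) (Fin n) ℝ) - (K - cutoff k K)) := by abel
  have hMpos : (cutoff k K + σn2 • (1 : Matrix (Fin n) (Fin n) ℝ)).PosDef := by
    rw [hM]
    exact (posDef_squaredExponential hx.injective hσ2 hl2).add_posSemidef hN
  have hcross : seCross xs x σ2 l2 = (seCross x xs σ2 l2)ᴴ := by
    ext i j
    simp only [seCross, Matrix.of_apply, conjTranspose_apply, star_trivial]
    rw [← neg_sub (x j) (xs i), neg_sq]
  have hinj : Function.Injective (Sum.elim x xs) :=
    hx.injective.sumElim hxs fun i j h => hdisj i j h.symm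
  have hblocks : fromBlocks (cutoff k K + σn2 • (1 : Matrix (Fin n) (Fin n) ℝ))
      (seCross x xs σ2 l2) (seCross x xs σ2 l2)ᴴ (seCross xs xs σ2 l2) =
      (Matrix.of fun i j => σ2 *
        Real.exp (-(Sum.elim x xs i - Sum.elim x xs j) ^ 2 / (2 * l2))) +
      fromBlocks (σn2 • (1 : Matrix (Fin n) (Fin n) ℝ) - (K - cutoff k K)) 0 0 0 := by
    rw [← hcross, hM]
    ext (i | i) (j | j) <;> simp [seCross, hK]
  have hNblock : (fromBlocks (σn2 • (1 : Matrix (Fin n) (Fin n) ℝ) - (K - cutoff k K)) 0 0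
      (0 : Matrix (Fin p) (Fin p) ℝ)).PosSemidef := by
    refine .of_dotProduct_mulVec_nonneg
      (hN.1.fromBlocks (by simp) Matrix.isHermitian_zero) fun z => ?_
    obtain ⟨u, w, rfl⟩ : ∃ u w, z = Sum.elim u w := ⟨_, _, (Sum.elim_comp_inl_inr z).symm⟩
    simpa [fromBlocks_mulVec, Function.star_sumElim] using hN.dotProduct_mulVec_nonneg u
  rw [hcross]
  refine hMpos.schurComplement ?_
  rw [hblocks]
  exact (posDef_squaredExponential hinj hσ2 hl2).add_posSemidef hNblock
end
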